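/- The map ∇ preserves the classical family algebra: if 𝒜 ∈ C_τ(𝔤), then ∇(𝒜) ∈ C_τ(𝔤). -/

import Mathlib

open TensorProduct MvPolynomial

noncomputable section

/-- The bilinear map `(a, b) ↦ u * D₁ a * D₂ b` on polynomials. -/
def bil {n : ℕ} (u : MvPolynomial (Fin n) ℂ)
    (D₁ D₂ : MvPolynomial (Fin n) ℂ →ₗ[ℂ] MvPolynomial (Fin n) ℂ) :
    MvPolynomial (Fin n) ℂ →ₗ[ℂ] MvPolynomial (Fin n) ℂ →ₗ[ℂ] MvPolynomial (Fin n) ℂ :=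
  (((LinearMap.mul ℂ (MvPolynomial (Fin n) ℂ)).comp
      ((LinearMap.mulLeft ℂ u).comp D₁)).compl₂ D₂)

/-- The Poisson bracket `{a,b} = Σ c^k_{ij} X_k (∂^i a)(∂^j b)` on `S(𝔤)`. -/
def Pb {n : ℕ} (c : Fin n → Fin n → Fin n → ℂ) :
    MvPolynomial (Fin n) ℂ →ₗ[ℂ] MvPolynomial (Fin n) ℂ →ₗ[ℂ] MvPolynomial (Fin n) ℂ :=
  ∑ i, ∑ j, ∑ k, c k i j •
    bil (X k) (pderiv i).toLinearMap (pderiv j).toLinearMap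

/-- `A ↦ [f, A]` on `End V`. -/
def adE {V : Type*} [AddCommGroup V] [Module ℂ V] (f : Module.End ℂ V) :
    Module.End ℂ V →ₗ[ℂ] Module.End ℂ V :=
  LinearMap.mulLeft ℂ f - LinearMap.mulRight ℂ f

/-- The diagonal `𝔤`-action of the basis vector `X_l` on `End V ⊗ S(𝔤)`. -/
def Dact {n : ℕ} (c : Fin n → Fin n → Fin n → ℂ) {V : Type*} [AddCommGroup V] [Module ℂ V]
    (τ : Fin n → Module.End ℂ V) (l : Fin n) :
    (Module.End ℂ V ⊗[ℂ] MvPolynomial (Fin n) ℂ) →ₗ[ℂ]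
      (Module.End ℂ V ⊗[ℂ] MvPolynomial (Fin n) ℂ) :=
  LinearMap.rTensor _ (adE (τ l)) + LinearMap.lTensor _ (Pb c (X l))

/-- The map `∇ : A ⊗ a ↦ Σₖ A·τ(Xₖ) ⊗ ∂^k(a)` on `End V ⊗ S(𝔤)`. -/
def nabla {n : ℕ} {V : Type*} [AddCommGroup V] [Module ℂ V]
    (τ : Fin n → Module.End ℂ V) :
    (Module.End ℂ V ⊗[ℂ] MvPolynomial (Fin n) ℂ) →ₗ[ℂ]
      (Module.End ℂ V ⊗[ℂ] MvPolynomial (Fin n) ℂ) :=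
  ∑ k, (LinearMap.mulRight ℂ ((τ k) ⊗ₜ[ℂ] (1 : MvPolynomial (Fin n) ℂ))).comp
    (LinearMap.lTensor (Module.End ℂ V) (pderiv k).toLinearMap)

theorem pderiv_pderiv_comm {σ R : Type*} [CommRing R] (i j : σ) (a : MvPolynomial σ R) :
    pderiv i (pderiv j a) = pderiv j (pderiv i a) := by
  have h : ⁅(pderiv i : Derivation R (MvPolynomial σ R) (MvPolynomial σ R)),
      (pderiv j : Derivation R (MvPolynomial σ R) (MvPolynomial σ R))⁆ = 0 := by
    classical
    ext k
    simp [Derivation.commutator_apply, pderiv_X, Pi.single_apply, apply_ite]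
  rw [← sub_eq_zero, ← Derivation.commutator_apply, h, Derivation.zero_apply]

theorem Pb_X_apply {n : ℕ} (c : Fin n → Fin n → Fin n → ℂ) (l : Fin n)
    (a : MvPolynomial (Fin n) ℂ) :
    Pb c (X l) a = ∑ j, ∑ k, c k l j • (X k * pderiv j a) := by
  simp only [Pb, bil, LinearMap.sum_apply, LinearMap.smul_apply, LinearMap.compl₂_apply,
    LinearMap.comp_apply, LinearMap.mulLeft_apply, LinearMap.mul_apply',
    Derivation.coeFn_coe]
  rw [Finset.sum_eq_single l]
  · simp
  · intro i _ hi
    simp [pderiv_X_of_ne hi.symm]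
  · simp

theorem pderiv_Pb_X {n : ℕ} (c : Fin n → Fin n → Fin n → ℂ) (l m : Fin n)
    (a : MvPolynomial (Fin n) ℂ) :
    pderiv m (Pb c (X l) a) = ∑ j, c m l j • pderiv j a + Pb c (X l) (pderiv m a) := by
  simp only [Pb_X_apply, map_sum, Derivation.map_smul, pderiv_mul, smul_add,
    Finset.sum_add_distrib, pderiv_pderiv_comm m]
  congr 1
  refine Finset.sum_congr rfl fun j _ => ?_
  rw [Finset.sum_eq_single m]
  · simp
  · intro k _ hk
    simp [pderiv_X_of_ne hk]
  · simp

theorem nabla_tmul {n : ℕ} {V : Type*} [AddCommGroup V] [Module ℂ V]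
    (τ : Fin n → Module.End ℂ V) (A : Module.End ℂ V) (a : MvPolynomial (Fin n) ℂ) :
    nabla τ (A ⊗ₜ[ℂ] a) = ∑ k, (A * τ k) ⊗ₜ[ℂ] pderiv k a := by
  simp [nabla, LinearMap.sum_apply]

theorem Dact_tmul {n : ℕ} (c : Fin n → Fin n → Fin n → ℂ) {V : Type*} [AddCommGroup V]
    [Module ℂ V] (τ : Fin n → Module.End ℂ V) (l : Fin n) (A : Module.End ℂ V)
    (a : MvPolynomial (Fin n) ℂ) :
    Dact c τ l (A ⊗ₜ[ℂ] a) = (τ l * A - A * τ l) ⊗ₜ[ℂ] a + A ⊗ₜ[ℂ] Pb c (X l) a := by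
  simp [Dact, adE, sub_tmul]

/-- `∇` is equivariant for the diagonal action. -/
theorem Dact_nabla {n : ℕ} (c : Fin n → Fin n → Fin n → ℂ) {V : Type*} [AddCommGroup V]
    [Module ℂ V] (τ : Fin n → Module.End ℂ V)
    (hτ : ∀ i j, τ i * τ j - τ j * τ i = ∑ k, c k i j • τ k) (l : Fin n)
    (x : Module.End ℂ V ⊗[ℂ] MvPolynomial (Fin n) ℂ) :
    Dact c τ l (nabla τ x) = nabla τ (Dact c τ l x) := by
  induction x with
  | zero => simp
  | add x y hx hy => simp only [map_add, hx, hy]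
  | tmul A a =>
    have leibniz (m : Fin n) : τ l * (A * τ m) - A * τ m * τ l =
        (τ l * A - A * τ l) * τ m + ∑ k, c k l m • (A * τ k) := by
      simp only [← mul_smul_comm]
      rw [← Finset.mul_sum, ← hτ l m]
      noncomm_ring
    simp only [nabla_tmul, Dact_tmul, map_sum, map_add, pderiv_Pb_X, leibniz, add_tmul, tmul_add,
      sum_tmul, tmul_sum, Finset.sum_add_distrib, smul_tmul, add_assoc]
    rw [Finset.sum_comm]

/-- `∇` preserves the classical family algebra. -/
theorem stmt14 {n : ℕ} (c : Fin n → Fin n → Fin n → ℂ)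
    {V : Type*} [AddCommGroup V] [Module ℂ V] (τ : Fin n → Module.End ℂ V)
    (hskew : ∀ k i j, c k i j = - c k j i)
    (hjac : ∀ i j l m, (∑ k, (c k i j * c m k l + c k j l * c m k i + c k l i * c m k j)) = 0)
    (hτ : ∀ i j, τ i * τ j - τ j * τ i = ∑ k, c k i j • τ k)
    (𝒜 : Module.End ℂ V ⊗[ℂ] MvPolynomial (Fin n) ℂ)
    (h𝒜 : ∀ l, Dact c τ l 𝒜 = 0) :
    ∀ l, Dact c τ l (nabla τ 𝒜) = 0 := by
  intro l
  rw [Dact_nabla c τ hτ, h𝒜, map_zero]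

end
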